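/- Over a field F (char F ≠ 2,3): (1) H(1,0) ∧ H(1,0) ≅ A(3 | 0); (2) H(0,1) ∧ H(0,1) ≅ A(1 | 0); (3) for m + n ≥ 2, H(m,n) ∧ H(m,n) ≅ A(r | s) with r = 2m² − m + n(n+1)/2 and s = 2mn; (4) H₁ ∧ H₁ ≅ A(1 | 2); (5) for m ≥ 2, H_m ∧ H_m ≅ A(m² | m²). -/

import Mathlib

/-!
Common definitions: Lie superalgebras over a field `F` (char ≠ 2,3 where needed),
graded ideals, centers, capability, epicenter, non-abelian tensor and exterior
products (characterized by generators-and-relations universal properties),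
free Lie superalgebras, Schur multipliers, Heisenberg Lie superalgebras, etc.
-/

namespace SuperLie

open Submodule Function Module

universe u v w

/-- The sign `(-1)^{|a||b|}` attached to a pair of `ℤ₂`-degrees. -/
def sg (F : Type u) [Field F] (a b : ZMod 2) : F := (-1 : F) ^ (a.val * b.val)

/-- A Lie superalgebra over `F`: a `ℤ₂`-graded vector space `L = L₀ ⊕ L₁`
together with an even bilinear bracket satisfying graded skew-symmetry and the
graded Jacobi identity (on homogeneous elements). -/
class LieSuper (F : Type u) [Field F] (L : Type v) [AddCommGroup L] [Module F L] where
  gr : ZMod 2 → Submodule F L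
  isCompl_gr : IsCompl (gr 0) (gr 1)
  br : L → L → L
  br_add_left : ∀ x y z : L, br (x + y) z = br x z + br y z
  br_add_right : ∀ x y z : L, br x (y + z) = br x y + br x z
  br_smul_left : ∀ (c : F) (x y : L), br (c • x) y = c • br x y
  br_smul_right : ∀ (c : F) (x y : L), br x (c • y) = c • br x y
  br_gr : ∀ a b : ZMod 2, ∀ x ∈ gr a, ∀ y ∈ gr b, br x y ∈ gr (a + b)
  br_skew : ∀ a b : ZMod 2, ∀ x ∈ gr a, ∀ y ∈ gr b, br x y = -(sg F a b) • br y x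
  br_jacobi : ∀ a b c : ZMod 2, ∀ x ∈ gr a, ∀ y ∈ gr b, ∀ z ∈ gr c,
    sg F a c • br x (br y z) + sg F b a • br y (br z x) + sg F c b • br z (br x y) = 0

/-- The `a`-graded piece of a Lie superalgebra. -/
def grd (F : Type u) [Field F] (L : Type v) [AddCommGroup L] [Module F L] [LieSuper F L]
    (a : ZMod 2) : Submodule F L :=
  LieSuper.gr a

/-- The bracket of a Lie superalgebra. -/
def sbr (F : Type u) [Field F] {L : Type v} [AddCommGroup L] [Module F L] [LieSuper F L]
    (x y : L) : L :=
  LieSuper.br (F := F) x y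

/-- The center `Z(L) = {z ∈ L : [z,x] = 0 for all x ∈ L}`. -/
def centerS (F : Type u) [Field F] (L : Type v) [AddCommGroup L] [Module F L] [LieSuper F L] :
    Submodule F L where
  carrier := {z : L | ∀ x : L, sbr F z x = 0}
  add_mem' := by
    intro a b ha hb x
    simp only [Set.mem_setOf_eq, sbr] at ha hb ⊢
    rw [LieSuper.br_add_left, ha x, hb x, add_zero]
  zero_mem' := by
    intro x
    have h := LieSuper.br_smul_left (F := F) (0 : F) (0 : L) x
    simp only [Set.mem_setOf_eq, sbr, zero_smul] at h ⊢
    simpa using h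
  smul_mem' := by
    intro c a ha x
    simp only [Set.mem_setOf_eq, sbr] at ha ⊢
    rw [LieSuper.br_smul_left, ha x, smul_zero]

/-- Homomorphisms of Lie superalgebras: even (grading preserving) linear maps
which preserve the bracket. -/
def IsHom (F : Type u) [Field F] {L : Type v} {M : Type w}
    [AddCommGroup L] [Module F L] [LieSuper F L]
    [AddCommGroup M] [Module F M] [LieSuper F M] (f : L →ₗ[F] M) : Prop :=
  (∀ a : ZMod 2, ∀ x ∈ grd F L a, f x ∈ grd F M a) ∧
  (∀ x y : L, f (sbr F x y) = sbr F (f x) (f y))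

/-- A bundled Lie superalgebra over `F`. -/
structure LieSupAlg (F : Type u) [Field F] : Type (max u (v + 1)) where
  carrier : Type v
  [iag : AddCommGroup carrier]
  [imo : Module F carrier]
  [ils : LieSuper F carrier]

attribute [instance] LieSupAlg.iag LieSupAlg.imo LieSupAlg.ils

instance (F : Type u) [Field F] : CoeSort (LieSupAlg.{u, v} F) (Type v) :=
  ⟨LieSupAlg.carrier⟩

/-- A Lie superalgebra `L` is capable if `L ≅ H/Z(H)` for some Lie superalgebra `H`,
i.e. there is a surjective homomorphism onto `L` whose kernel is exactly the center. -/
def Capable (F : Type u) [Field F] (L : Type v) [AddCommGroup L] [Module F L]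
    [LieSuper F L] : Prop :=
  ∃ (H : LieSupAlg.{u, max u v} F) (φ : H.carrier →ₗ[F] L),
    IsHom F φ ∧ Surjective φ ∧ LinearMap.ker φ = centerS F H.carrier

/-- Graded ideals of a Lie superalgebra. -/
def IsGIdeal (F : Type u) [Field F] {L : Type v} [AddCommGroup L] [Module F L]
    [LieSuper F L] (I : Submodule F L) : Prop :=
  (∀ x ∈ I, ∀ y : L, sbr F x y ∈ I) ∧ (∀ y : L, ∀ x ∈ I, sbr F y x ∈ I) ∧
  (∀ x ∈ I, ∃ x0 ∈ I ⊓ grd F L 0, ∃ x1 ∈ I ⊓ grd F L 1, x = x0 + x1)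

/-- The graded ideal generated by a subset. -/
def idealClosure (F : Type u) [Field F] {L : Type v} [AddCommGroup L] [Module F L]
    [LieSuper F L] (S : Set L) : Submodule F L :=
  sInf {I : Submodule F L | IsGIdeal F I ∧ S ⊆ ↑I}

/-- `QuotCapable F L N` expresses that the quotient Lie superalgebra `L/N` is capable. -/
def QuotCapable (F : Type u) [Field F] (L : Type v) [AddCommGroup L] [Module F L]
    [LieSuper F L] (N : Submodule F L) : Prop :=
  ∃ (Q : LieSupAlg.{u, max u v} F) (π : L →ₗ[F] Q.carrier),
    IsHom F π ∧ Surjective π ∧ LinearMap.ker π = N ∧ Capable F Q.carrier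

/-- The epicenter `Z^*(L)`: the smallest graded ideal of `L` such that the
corresponding quotient is capable. -/
def IsEpicenter (F : Type u) [Field F] (L : Type v) [AddCommGroup L] [Module F L]
    [LieSuper F L] (Z : Submodule F L) : Prop :=
  IsGIdeal F Z ∧ QuotCapable F L Z ∧
  ∀ N : Submodule F L, IsGIdeal F N → QuotCapable F L N → Z ≤ N

/-- The submodule `[I,J]` spanned by brackets. -/
def bracketSpan (F : Type u) [Field F] {L : Type v} [AddCommGroup L] [Module F L]
    [LieSuper F L] (I J : Submodule F L) : Submodule F L :=
  Submodule.span F {z : L | ∃ x ∈ I, ∃ y ∈ J, z = sbr F x y}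

/-- The derived subalgebra `L' = [L,L]`. -/
def derived (F : Type u) [Field F] (L : Type v) [AddCommGroup L] [Module F L]
    [LieSuper F L] : Submodule F L :=
  bracketSpan F (⊤ : Submodule F L) ⊤

/-- The lower central series of a Lie superalgebra. -/
def lowerCentral (F : Type u) [Field F] (L : Type v) [AddCommGroup L] [Module F L]
    [LieSuper F L] : ℕ → Submodule F L
  | 0 => ⊤
  | n + 1 => bracketSpan F (lowerCentral F L n) ⊤

/-- A Lie superalgebra is nilpotent if its lower central series terminates at zero. -/
def IsNilp (F : Type u) [Field F] (L : Type v) [AddCommGroup L] [Module F L]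
    [LieSuper F L] : Prop :=
  ∃ n : ℕ, lowerCentral F L n = ⊥

/-- An action of a Lie superalgebra `P` on a Lie superalgebra `M`:
an even bilinear map satisfying the two action axioms. -/
structure IsAction (F : Type u) [Field F] {P : Type v} {M : Type v}
    [AddCommGroup P] [Module F P] [LieSuper F P]
    [AddCommGroup M] [Module F M] [LieSuper F M] (act : P → M → M) : Prop where
  add_left : ∀ (p q : P) (m : M), act (p + q) m = act p m + act q m
  add_right : ∀ (p : P) (m m' : M), act p (m + m') = act p m + act p m'
  smul_left : ∀ (c : F) (p : P) (m : M), act (c • p) m = c • act p m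
  smul_right : ∀ (c : F) (p : P) (m : M), act p (c • m) = c • act p m
  grade : ∀ a b : ZMod 2, ∀ p ∈ grd F P a, ∀ m ∈ grd F M b, act p m ∈ grd F M (a + b)
  br_act : ∀ a b : ZMod 2, ∀ p ∈ grd F P a, ∀ p' ∈ grd F P b, ∀ m : M,
    act (sbr F p p') m = act p (act p' m) - sg F a b • act p' (act p m)
  act_br : ∀ a b : ZMod 2, ∀ p ∈ grd F P a, ∀ m ∈ grd F M b, ∀ m' : M,
    act p (sbr F m m') = sbr F (act p m) m' + sg F a b • sbr F m (act p m')

/-- Compatibility of mutual actions of two Lie superalgebras on each other. -/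
def Compatible (F : Type u) [Field F] {M : Type v} {N : Type v}
    [AddCommGroup M] [Module F M] [LieSuper F M]
    [AddCommGroup N] [Module F N] [LieSuper F N]
    (actMN : M → N → N) (actNM : N → M → M) : Prop :=
  (∀ a b : ZMod 2, ∀ m ∈ grd F M a, ∀ n ∈ grd F N b, ∀ n' : N,
      actMN (actNM n m) n' = -(sg F a b) • sbr F (actMN m n) n') ∧
  (∀ a b : ZMod 2, ∀ m ∈ grd F M a, ∀ n ∈ grd F N b, ∀ m' : M,
      actNM (actMN m n) m' = -(sg F a b) • sbr F (actNM n m) m')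

/-- The defining relations of the non-abelian tensor product `M ⊗ N` of Lie
superalgebras (with given mutual actions), satisfied by a pairing `q` into `T`. -/
structure TensorRel (F : Type u) [Field F] {M : Type v} {N : Type v} {T : Type w}
    [AddCommGroup M] [Module F M] [LieSuper F M]
    [AddCommGroup N] [Module F N] [LieSuper F N]
    [AddCommGroup T] [Module F T] [LieSuper F T]
    (actMN : M → N → N) (actNM : N → M → M) (q : M → N → T) : Prop where
  add_left : ∀ (m m' : M) (n : N), q (m + m') n = q m n + q m' n
  add_right : ∀ (m : M) (n n' : N), q m (n + n') = q m n + q m n'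
  smul_left : ∀ (c : F) (m : M) (n : N), q (c • m) n = c • q m n
  smul_right : ∀ (c : F) (m : M) (n : N), q m (c • n) = c • q m n
  grade : ∀ a b : ZMod 2, ∀ m ∈ grd F M a, ∀ n ∈ grd F N b, q m n ∈ grd F T (a + b)
  brk_left : ∀ a b : ZMod 2, ∀ m ∈ grd F M a, ∀ m' ∈ grd F M b, ∀ n : N,
    q (sbr F m m') n = q m (actMN m' n) - sg F a b • q m' (actMN m n)
  brk_right : ∀ a b c : ZMod 2, ∀ m ∈ grd F M a, ∀ n ∈ grd F N b, ∀ n' ∈ grd F N c,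
    q m (sbr F n n') = sg F c (a + b) • q (actNM n' m) n - sg F a b • q (actNM n m) n'
  brk_brk : ∀ a b : ZMod 2, ∀ m ∈ grd F M a, ∀ n ∈ grd F N b, ∀ (m' : M) (n' : N),
    sbr F (q m n) (q m' n') = -(sg F a b) • q (actNM n m) (actMN m' n')

/-- `IsTensorObj F actMN actNM t` says that `(T, t)` is the non-abelian tensor
product `M ⊗ N`: the pairing `t` satisfies the defining relations and is
universal among all pairings satisfying them. -/
structure IsTensorObj (F : Type u) [Field F] {M : Type v} {N : Type v} {T : Type v}
    [AddCommGroup M] [Module F M] [LieSuper F M]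
    [AddCommGroup N] [Module F N] [LieSuper F N]
    [AddCommGroup T] [Module F T] [LieSuper F T]
    (actMN : M → N → N) (actNM : N → M → M) (t : M → N → T) : Prop where
  rel : TensorRel F actMN actNM t
  lift : ∀ (Q : LieSupAlg.{u, max u v} F) (q : M → N → Q.carrier),
    TensorRel F actMN actNM q →
    ∃! h : T →ₗ[F] Q.carrier, IsHom F h ∧ ∀ (m : M) (n : N), h (t m n) = q m n

/-- The defining relations of the non-abelian exterior square `L ∧ L` of a Lie
superalgebra (the tensor relations for the bracket actions, together with the
graded alternating relations coming from `L □ L`). -/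
structure ExtRel (F : Type u) [Field F] {L : Type v} {T : Type w}
    [AddCommGroup L] [Module F L] [LieSuper F L]
    [AddCommGroup T] [Module F T] [LieSuper F T] (q : L → L → T) : Prop where
  toTensor : TensorRel F (fun x y : L => sbr F x y) (fun x y : L => sbr F x y) q
  alt : ∀ a b : ZMod 2, ∀ x ∈ grd F L a, ∀ y ∈ grd F L b, q x y = -(sg F a b) • q y x
  alt_even : ∀ x ∈ grd F L 0, q x x = 0

/-- `IsExtObj F t` says that `(E, t)` is the non-abelian exterior square `L ∧ L`. -/
structure IsExtObj (F : Type u) [Field F] {L : Type v} {E : Type v}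
    [AddCommGroup L] [Module F L] [LieSuper F L]
    [AddCommGroup E] [Module F E] [LieSuper F E] (t : L → L → E) : Prop where
  rel : ExtRel F t
  lift : ∀ (Q : LieSupAlg.{u, max u v} F) (q : L → L → Q.carrier),
    ExtRel F q →
    ∃! h : E →ₗ[F] Q.carrier, IsHom F h ∧ ∀ x y : L, h (t x y) = q x y

/-- A free Lie superalgebra: free on some `ℤ₂`-graded subset `X`. -/
def IsFreeLieSuper (F : Type u) [Field F] (Fr : Type v) [AddCommGroup Fr] [Module F Fr]
    [LieSuper F Fr] : Prop :=
  ∃ X : ZMod 2 → Set Fr,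
    (∀ a : ZMod 2, X a ⊆ (grd F Fr a : Set Fr)) ∧
    ∀ (Q : LieSupAlg.{u, max u v} F) (f : ∀ a : ZMod 2, X a → Q.carrier),
      (∀ (a : ZMod 2) (x : X a), f a x ∈ grd F Q.carrier a) →
      ∃! h : Fr →ₗ[F] Q.carrier,
        IsHom F h ∧ ∀ (a : ZMod 2) (x : X a), h (x : Fr) = f a x

/-- `F' ∩ R`, for a free presentation with kernel `R`. -/
abbrev schurA (F : Type u) [Field F] (Fr : Type v) [AddCommGroup Fr] [Module F Fr]
    [LieSuper F Fr] (R : Submodule F Fr) : Submodule F Fr :=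
  derived F Fr ⊓ R

/-- The Schur multiplier `M(L) = (F' ∩ R)/[R,F]` attached to a free presentation
`0 → R → F → L → 0`. -/
abbrev SchurMul (F : Type u) [Field F] (Fr : Type v) [AddCommGroup Fr] [Module F Fr]
    [LieSuper F Fr] (R : Submodule F Fr) :=
  ↥(schurA F Fr R) ⧸ (Submodule.comap (schurA F Fr R).subtype (bracketSpan F R ⊤))

/-- `L` is (isomorphic to) the special Heisenberg Lie superalgebra `H(m,n)` with even
center: basis `x₁,…,x_{2m}, z` (even), `y₁,…,y_n` (odd), with `[xᵢ, x_{m+i}] = z`,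
`[y_j, y_j] = z` and `z` central. -/
def IsHeisE (F : Type u) [Field F] (m n : ℕ) (L : Type v) [AddCommGroup L] [Module F L]
    [LieSuper F L] : Prop :=
  ∃ (x : Fin (2 * m) → L) (y : Fin n → L) (z : L),
    (∀ i, x i ∈ grd F L 0) ∧ z ∈ grd F L 0 ∧ (∀ j, y j ∈ grd F L 1) ∧
    LinearIndependent F (Sum.elim x (Sum.elim y (fun _ : Unit => z))) ∧
    Submodule.span F (Set.range (Sum.elim x (Sum.elim y (fun _ : Unit => z)))) = ⊤ ∧
    (∀ i j : Fin (2 * m), sbr F (x i) (x j) =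
      if (j : ℕ) = (i : ℕ) + m then z else if (i : ℕ) = (j : ℕ) + m then -z else 0) ∧
    (∀ (i : Fin (2 * m)) (j : Fin n), sbr F (x i) (y j) = 0) ∧
    (∀ (i : Fin (2 * m)) (j : Fin n), sbr F (y j) (x i) = 0) ∧
    (∀ i j : Fin n, sbr F (y i) (y j) = if i = j then z else 0) ∧
    (∀ w : L, sbr F z w = 0) ∧ (∀ w : L, sbr F w z = 0)

/-- `L` is (isomorphic to) the Heisenberg Lie superalgebra `H_m` with odd center:
basis `x₁,…,x_m` (even), `y₁,…,y_m, z` (odd), with `[x_j, y_j] = z` and `z` central. -/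
def IsHeisO (F : Type u) [Field F] (m : ℕ) (L : Type v) [AddCommGroup L] [Module F L]
    [LieSuper F L] : Prop :=
  ∃ (x : Fin m → L) (y : Fin m → L) (z : L),
    (∀ i, x i ∈ grd F L 0) ∧ (∀ j, y j ∈ grd F L 1) ∧ z ∈ grd F L 1 ∧
    LinearIndependent F (Sum.elim x (Sum.elim y (fun _ : Unit => z))) ∧
    Submodule.span F (Set.range (Sum.elim x (Sum.elim y (fun _ : Unit => z)))) = ⊤ ∧
    (∀ i j : Fin m, sbr F (x i) (x j) = 0) ∧
    (∀ i j : Fin m, sbr F (x i) (y j) = if i = j then z else 0) ∧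
    (∀ i j : Fin m, sbr F (y j) (x i) = if i = j then -z else 0) ∧
    (∀ i j : Fin m, sbr F (y i) (y j) = 0) ∧
    (∀ w : L, sbr F z w = 0) ∧ (∀ w : L, sbr F w z = 0)

/-- `A` is (isomorphic to) the abelian Lie superalgebra `A(r | s)` of
superdimension `(r | s)`. -/
def IsAbelSuper (F : Type u) [Field F] (r s : ℕ) (A : Type v) [AddCommGroup A]
    [Module F A] [LieSuper F A] : Prop :=
  (∀ x y : A, sbr F x y = 0) ∧ Module.Finite F A ∧
  Module.finrank F ↥(grd F A 0) = r ∧ Module.finrank F ↥(grd F A 1) = s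

/-- The direct sum (product) of two Lie superalgebras. -/
instance prodLieSuper (F : Type u) [Field F] (A : Type v) (B : Type w)
    [AddCommGroup A] [Module F A] [LieSuper F A]
    [AddCommGroup B] [Module F B] [LieSuper F B] : LieSuper F (A × B) where
  gr a := (grd F A a).prod (grd F B a)
  isCompl_gr := by
    have hA : IsCompl (grd F A 0) (grd F A 1) := LieSuper.isCompl_gr
    have hB : IsCompl (grd F B 0) (grd F B 1) := LieSuper.isCompl_gr
    constructor
    · rw [disjoint_iff, eq_bot_iff]
      rintro ⟨a, b⟩ h
      rw [Submodule.mem_inf] at h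
      obtain ⟨h0, h1⟩ := h
      rw [Submodule.mem_prod] at h0 h1
      have ha : a = 0 := by
        have := hA.disjoint.le_bot (Submodule.mem_inf.mpr ⟨h0.1, h1.1⟩)
        simpa using this
      have hb : b = 0 := by
        have := hB.disjoint.le_bot (Submodule.mem_inf.mpr ⟨h0.2, h1.2⟩)
        simpa using this
      simp [ha, hb, Prod.ext_iff]
    · rw [codisjoint_iff, eq_top_iff]
      rintro ⟨a, b⟩ -
      have ha' : a ∈ grd F A 0 ⊔ grd F A 1 := by
        rw [hA.codisjoint.eq_top]; trivial
      have hb' : b ∈ grd F B 0 ⊔ grd F B 1 := by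
        rw [hB.codisjoint.eq_top]; trivial
      obtain ⟨a0, ha0, a1, ha1, rfl⟩ := Submodule.mem_sup.mp ha'
      obtain ⟨b0, hb0, b1, hb1, rfl⟩ := Submodule.mem_sup.mp hb'
      refine Submodule.mem_sup.mpr ⟨(a0, b0), ?_, (a1, b1), ?_, ?_⟩
      · exact Submodule.mem_prod.mpr ⟨ha0, hb0⟩
      · exact Submodule.mem_prod.mpr ⟨ha1, hb1⟩
      · rfl
  br x y := (sbr F x.1 y.1, sbr F x.2 y.2)
  br_add_left := by
    intro x y z
    simp only [Prod.fst_add, Prod.snd_add, sbr, LieSuper.br_add_left]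
    rfl
  br_add_right := by
    intro x y z
    simp only [Prod.fst_add, Prod.snd_add, sbr, LieSuper.br_add_right]
    rfl
  br_smul_left := by
    intro c x y
    simp only [Prod.smul_fst, Prod.smul_snd, sbr, LieSuper.br_smul_left]
    rfl
  br_smul_right := by
    intro c x y
    simp only [Prod.smul_fst, Prod.smul_snd, sbr, LieSuper.br_smul_right]
    rfl
  br_gr := by
    intro a b x hx y hy
    rw [Submodule.mem_prod] at hx hy ⊢
    exact ⟨LieSuper.br_gr a b x.1 hx.1 y.1 hy.1, LieSuper.br_gr a b x.2 hx.2 y.2 hy.2⟩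
  br_skew := by
    intro a b x hx y hy
    rw [Submodule.mem_prod] at hx hy
    have h1 := LieSuper.br_skew (F := F) a b x.1 hx.1 y.1 hy.1
    have h2 := LieSuper.br_skew (F := F) a b x.2 hx.2 y.2 hy.2
    simp only [sbr]
    rw [Prod.ext_iff]
    exact ⟨h1, h2⟩
  br_jacobi := by
    intro a b c x hx y hy z hz
    rw [Submodule.mem_prod] at hx hy hz
    have h1 := LieSuper.br_jacobi (F := F) a b c x.1 hx.1 y.1 hy.1 z.1 hz.1
    have h2 := LieSuper.br_jacobi (F := F) a b c x.2 hx.2 y.2 hy.2 z.2 hz.2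
    simp only [sbr]
    rw [Prod.ext_iff]
    exact ⟨h1, h2⟩

section aux

variable {F : Type u} [Field F]

theorem sg_comm' (a b : ZMod 2) : sg F a b = sg F b a := by
  simp [sg, Nat.mul_comm]

theorem sg_cases (a b : ZMod 2) : sg F a b = 1 ∨ sg F a b = -1 := by
  unfold sg; exact neg_one_pow_eq_or F _

theorem zmod2_cases (a : ZMod 2) : a = 0 ∨ a = 1 := by
  revert a; decide

theorem zmod2_ne (a c : ZMod 2) (h : ¬ c = a) : c = a + 1 := by
  revert a c; decide

theorem zmod2_ne' (a : ZMod 2) : a ≠ a + 1 := by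
  revert a; decide

theorem sg_zero_left (a : ZMod 2) : sg F 0 a = 1 := by simp [sg]
theorem sg_zero_right (a : ZMod 2) : sg F a 0 = 1 := by simp [sg]
theorem sg_one_one : sg F 1 1 = -1 := by
  have : (1 : ZMod 2).val = 1 := rfl
  simp [sg, this]

section basic
variable {L : Type v} [AddCommGroup L] [Module F L] [LieSuper F L]

theorem sbr_add_left (x y z : L) : sbr F (x + y) z = sbr F x z + sbr F y z :=
  LieSuper.br_add_left x y z
theorem sbr_add_right (x y z : L) : sbr F x (y + z) = sbr F x y + sbr F x z :=
  LieSuper.br_add_right x y z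
theorem sbr_smul_left (c : F) (x y : L) : sbr F (c • x) y = c • sbr F x y :=
  LieSuper.br_smul_left c x y
theorem sbr_smul_right (c : F) (x y : L) : sbr F x (c • y) = c • sbr F x y :=
  LieSuper.br_smul_right c x y
theorem sbr_zero_left (y : L) : sbr F 0 y = 0 := by
  have := sbr_smul_left (F := F) 0 (0 : L) y
  simpa using this
theorem sbr_zero_right (y : L) : sbr F y 0 = 0 := by
  have := sbr_smul_right (F := F) 0 y (0 : L)
  simpa using this
theorem sbr_skew (a b : ZMod 2) (x y : L) (hx : x ∈ grd F L a) (hy : y ∈ grd F L b) :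
    sbr F x y = -(sg F a b) • sbr F y x := LieSuper.br_skew a b x hx y hy
theorem sbr_mem (a b : ZMod 2) (x y : L) (hx : x ∈ grd F L a) (hy : y ∈ grd F L b) :
    sbr F x y ∈ grd F L (a + b) := LieSuper.br_gr a b x hx y hy

theorem grd_disj (a c : ZMod 2) (hac : a ≠ c) (x : L) (h1 : x ∈ grd F L a)
    (h2 : x ∈ grd F L c) : x = 0 := by
  have hd := (LieSuper.isCompl_gr (F := F) (L := L)).disjoint
  rw [Submodule.disjoint_def] at hd
  rcases zmod2_cases a with rfl | rfl <;> rcases zmod2_cases c with rfl | rfl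
  · exact absurd rfl hac
  · exact hd x h1 h2
  · exact hd x h2 h1
  · exact absurd rfl hac

variable {κ : Type} [Fintype κ] [DecidableEq κ] (b : Basis κ F L) (p : κ → ZMod 2)

theorem repr_zero_of (hp : ∀ α, b α ∈ grd F L (p α)) (a : ZMod 2) (x : L)
    (hx : x ∈ grd F L a) (α : κ) (hα : p α ≠ a) : b.repr x α = 0 := by
  set y : L := ∑ γ, if p γ = a then b.repr x γ • b γ else 0 with hy
  set w : L := ∑ γ, if p γ = a then 0 else b.repr x γ • b γ with hw
  have hyw : x = y + w := by
    rw [hy, hw, ← Finset.sum_add_distrib]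
    conv_lhs => rw [← b.sum_repr x]
    refine Finset.sum_congr rfl fun γ _ => ?_
    split_ifs <;> simp
  have hya : y ∈ grd F L a := by
    refine Submodule.sum_mem _ fun γ _ => ?_
    split_ifs with h
    · exact Submodule.smul_mem _ _ (h ▸ hp γ)
    · exact Submodule.zero_mem _
  have hwa : w ∈ grd F L (a + 1) := by
    refine Submodule.sum_mem _ fun γ _ => ?_
    split_ifs with h
    · exact Submodule.zero_mem _
    · have : p γ = a + 1 := zmod2_ne _ _ h
      exact Submodule.smul_mem _ _ (this ▸ hp γ)
  have hwa' : w ∈ grd F L a := by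
    have : w = x - y := by rw [hyw]; abel
    rw [this]; exact Submodule.sub_mem _ hx hya
  have hw0 : w = 0 := grd_disj a (a + 1) (zmod2_ne' a) w hwa' hwa
  have h1 : b.repr w α = b.repr x α := by
    rw [hw, map_sum, Finset.sum_apply']
    rw [Finset.sum_eq_single α]
    · simp [hα]
    · intro γ _ hγ
      split_ifs <;> simp [hγ]
    · simp
  rw [← h1, hw0]; simp

theorem gr_ind (hp : ∀ α, b α ∈ grd F L (p α)) (a : ZMod 2) (P : L → Prop)
    (h0 : P 0) (hadd : ∀ x y, P x → P y → P (x + y)) (hs : ∀ (c : F) x, P x → P (c • x))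
    (hb : ∀ α, p α = a → P (b α)) (x : L) (hx : x ∈ grd F L a) : P x := by
  rw [← b.sum_repr x]
  refine Finset.sum_induction _ P hadd h0 fun γ _ => ?_
  by_cases h : p γ = a
  · exact hs _ _ (hb _ h)
  · rw [repr_zero_of b p hp a x hx γ h, zero_smul]; exact h0

omit [DecidableEq κ] [LieSuper F L] in
theorem all_ind (P : L → Prop)
    (h0 : P 0) (hadd : ∀ x y, P x → P y → P (x + y)) (hs : ∀ (c : F) x, P x → P (c • x))
    (hb : ∀ α, P (b α)) (x : L) : P x := by
  rw [← b.sum_repr x]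
  exact Finset.sum_induction _ P hadd h0 fun γ _ => hs _ _ (hb _)

/-- elementary pairing -/
noncomputable def Bf (s : κ × κ) (x y : L) : F :=
  b.repr x s.1 * b.repr y s.2 +
    (if s.1 = s.2 then 0 else -(sg F (p s.1) (p s.2))) * (b.repr x s.2 * b.repr y s.1)

/-- values on the basis -/
def Bc (F : Type u) [Field F] (p : κ → ZMod 2) (s : κ × κ) (α β : κ) : F :=
  if α = s.1 ∧ β = s.2 then 1 else if α = s.2 ∧ β = s.1 then -(sg F (p s.1) (p s.2)) else 0

omit [Fintype κ] [LieSuper F L] in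
theorem Bf_basis (s : κ × κ) (α β : κ) : Bf b p s (b α) (b β) = Bc F p s α β := by
  obtain ⟨u, v⟩ := s
  simp only [Bf, Bc, Basis.repr_self, Finsupp.single_apply]
  by_cases h1 : α = u <;> by_cases h2 : β = v <;> by_cases h3 : α = v <;> by_cases h4 : β = u <;>
    by_cases h5 : u = v <;> simp_all

omit [Fintype κ] [LieSuper F L] in
theorem Bf_add_left (s : κ × κ) (x y w : L) : Bf b p s (x + y) w = Bf b p s x w + Bf b p s y w := by
  simp only [Bf, map_add, Finsupp.add_apply]; ring
omit [Fintype κ] [LieSuper F L] in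
theorem Bf_add_right (s : κ × κ) (x y w : L) : Bf b p s w (x + y) = Bf b p s w x + Bf b p s w y := by
  simp only [Bf, map_add, Finsupp.add_apply]; ring
omit [Fintype κ] [LieSuper F L] in
theorem Bf_smul_left (s : κ × κ) (c : F) (x w : L) : Bf b p s (c • x) w = c * Bf b p s x w := by
  simp only [Bf, map_smul, Finsupp.smul_apply, smul_eq_mul]; ring
omit [Fintype κ] [LieSuper F L] in
theorem Bf_smul_right (s : κ × κ) (c : F) (x w : L) : Bf b p s w (c • x) = c * Bf b p s w x := by
  simp only [Bf, map_smul, Finsupp.smul_apply, smul_eq_mul]; ring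
omit [Fintype κ] [LieSuper F L] in
theorem Bf_zero_left (s : κ × κ) (w : L) : Bf b p s 0 w = 0 := by
  simp [Bf]
omit [Fintype κ] [LieSuper F L] in
theorem Bf_zero_right (s : κ × κ) (w : L) : Bf b p s w 0 = 0 := by
  simp [Bf]

theorem Bf_grade (hp : ∀ α, b α ∈ grd F L (p α)) (s : κ × κ) (a c : ZMod 2) (x y : L)
    (hx : x ∈ grd F L a) (hy : y ∈ grd F L c) (h : p s.1 + p s.2 ≠ a + c) :
    Bf b p s x y = 0 := by
  have h1 : b.repr x s.1 * b.repr y s.2 = 0 := by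
    by_cases h1 : p s.1 = a
    · rw [repr_zero_of b p hp c y hy s.2 (by rintro rfl; exact h (by rw [h1])), mul_zero]
    · rw [repr_zero_of b p hp a x hx s.1 h1, zero_mul]
  have h2 : b.repr x s.2 * b.repr y s.1 = 0 := by
    by_cases h1 : p s.2 = a
    · rw [repr_zero_of b p hp c y hy s.1 (by rintro rfl; exact h (by rw [h1, add_comm])), mul_zero]
    · rw [repr_zero_of b p hp a x hx s.2 h1, zero_mul]
  simp [Bf, h1, h2]

theorem Bf_alt (hp : ∀ α, b α ∈ grd F L (p α)) (s : κ × κ) (hs : s.1 = s.2 → p s.1 = 1)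
    (a c : ZMod 2) (x y : L)
    (hx : x ∈ grd F L a) (hy : y ∈ grd F L c) :
    Bf b p s x y = -(sg F a c) * Bf b p s y x := by
  refine gr_ind b p hp a (fun x => Bf b p s x y = -(sg F a c) * Bf b p s y x) ?_ ?_ ?_ ?_ x hx
  · simp [Bf_zero_left, Bf_zero_right]
  · intro x y h1 h2; rw [Bf_add_left, Bf_add_right, h1, h2]; ring
  · intro c x h; rw [Bf_smul_left, Bf_smul_right, h]; ring
  · intro α hα
    refine gr_ind b p hp c (fun y => Bf b p s (b α) y = -(sg F a c) * Bf b p s y (b α))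
      ?_ ?_ ?_ ?_ y hy
    · simp [Bf_zero_left, Bf_zero_right]
    · intro x y h1 h2; rw [Bf_add_left, Bf_add_right, h1, h2]; ring
    · intro c x h; rw [Bf_smul_left, Bf_smul_right, h]; ring
    · intro β hβ
      rw [Bf_basis, Bf_basis]
      obtain ⟨u, v⟩ := s
      subst hα hβ
      simp only [Bc] at hs ⊢
      have hss : sg F (p u) (p v) * sg F (p u) (p v) = 1 := by
        rcases sg_cases (F := F) (p u) (p v) with h | h <;> rw [h] <;> ring
      by_cases h5 : u = v
      · subst h5
        by_cases h1 : α = u <;> by_cases h2 : β = u <;> simp [h1, h2, hs, sg_one_one]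
      · by_cases h1 : α = u
        · subst h1
          by_cases h2 : β = v
          · subst h2; simp [h5, hss]
          · simp [h2, h5]
        · by_cases h3 : α = v
          · subst h3
            by_cases h4 : β = u
            · subst h4; simp [Ne.symm h5, sg_comm']
            · simp [h1, h4]
          · simp [h1, h3]

end basic

/-- abelian superalgebra on functions -/
@[reducible] def absLS (F : Type u) [Field F] {ι : Type v} (p : ι → ZMod 2) : LieSuper F (ι → F) where
  gr a :=
    { carrier := {f | ∀ i, p i ≠ a → f i = 0}
      add_mem' := by
        intro f g hf hg i hi
        simp [hf i hi, hg i hi]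
      zero_mem' := by intro i _; rfl
      smul_mem' := by
        intro c f hf i hi
        simp [hf i hi] }
  isCompl_gr := by
    constructor
    · rw [Submodule.disjoint_def]
      intro f h0 h1
      funext i
      rcases zmod2_cases (p i) with h | h
      · exact h1 i (by rw [h]; decide)
      · exact h0 i (by rw [h]; decide)
    · rw [codisjoint_iff, eq_top_iff]
      intro f _
      refine Submodule.mem_sup.mpr ⟨fun i => if p i = 0 then f i else 0, ?_,
        fun i => if p i = 0 then 0 else f i, ?_, ?_⟩
      · intro i hi
        simp [hi]
      · intro i hi
        rcases zmod2_cases (p i) with h | h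
        · simp [h]
        · exact absurd h hi
      · funext i
        simp only [Pi.add_apply]
        split_ifs <;> simp
  br _ _ := 0
  br_add_left := by intros; simp
  br_add_right := by intros; simp
  br_smul_left := by intros; simp
  br_smul_right := by intros; simp
  br_gr := by intros; exact Submodule.zero_mem _
  br_skew := by intros; simp
  br_jacobi := by intros; simp

/-- universe lift -/
@[reducible] def ulLS (F : Type u) [Field F] (L : Type v) [AddCommGroup L] [Module F L] [LieSuper F L] :
    LieSuper F (ULift.{w} L) where
  gr a := (grd F L a).comap (ULift.moduleEquiv (R := F) (M := L)).toLinearMap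
  isCompl_gr := by
    have h := LieSuper.isCompl_gr (F := F) (L := L)
    constructor
    · rw [Submodule.disjoint_def]
      rintro ⟨f⟩ h0 h1
      exact congrArg ULift.up (Submodule.disjoint_def.mp h.disjoint f h0 h1)
    · rw [codisjoint_iff, eq_top_iff]
      rintro ⟨f⟩ _
      have hf : f ∈ LieSuper.gr (F := F) (L := L) 0 ⊔ LieSuper.gr 1 := by
        rw [h.codisjoint.eq_top]; trivial
      obtain ⟨a0, ha0, a1, ha1, rfl⟩ := Submodule.mem_sup.mp hf
      exact Submodule.mem_sup.mpr ⟨⟨a0⟩, ha0, ⟨a1⟩, ha1, rfl⟩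
  br x y := ⟨sbr F x.down y.down⟩
  br_add_left := by intro x y z; exact congrArg ULift.up (sbr_add_left _ _ _)
  br_add_right := by intro x y z; exact congrArg ULift.up (sbr_add_right _ _ _)
  br_smul_left := by intro x y z; exact congrArg ULift.up (sbr_smul_left _ _ _)
  br_smul_right := by intro x y z; exact congrArg ULift.up (sbr_smul_right _ _ _)
  br_gr := by intro a b x hx y hy; exact LieSuper.br_gr a b x.down hx y.down hy
  br_skew := by
    intro a b x hx y hy
    exact congrArg ULift.up (LieSuper.br_skew a b x.down hx y.down hy)
  br_jacobi := by
    intro a b c x hx y hy z hz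
    exact congrArg ULift.up (LieSuper.br_jacobi a b c x.down hx y.down hy z.down hz)

theorem finrank_abs {ι : Type v} [Fintype ι] (p : ι → ZMod 2) (a : ZMod 2) :
    Module.finrank F ↥((absLS F p).gr a) = Fintype.card {i // p i = a} := by
  classical
  let e : ↥((absLS F p).gr a) ≃ₗ[F] ({i // p i = a} → F) :=
    { toFun := fun f i => f.1 i.1
      map_add' := by intros; rfl
      map_smul' := by intros; rfl
      invFun := fun g => ⟨fun i => if h : p i = a then g ⟨i, h⟩ else 0, by
        intro i hi
        simp [hi]⟩
      left_inv := by
        intro f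
        ext i
        by_cases h : p i = a
        · simp [h]
        · simp [h, f.2 i h]
      right_inv := by
        intro g
        funext i
        simp [i.2] }
  rw [e.finrank_eq, Module.finrank_fintype_fun_eq_card]


/-- the model pairing -/
noncomputable def qM {L : Type v} [AddCommGroup L] [Module F L]
    {κ : Type} [DecidableEq κ] (b : Basis κ F L) (p : κ → ZMod 2) (S : Finset (κ × κ))
    (x y : L) : ULift.{v} ↥S → F := fun i => Bf b p i.down.1 x y

theorem Bc_cocycle {L : Type v} [AddCommGroup L] [Module F L] [LieSuper F L]
    {κ : Type} [Fintype κ] [DecidableEq κ] (b : Basis κ F L) (p : κ → ZMod 2)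
    (hp : ∀ α, b α ∈ grd F L (p α)) (z : κ) (ω : κ → κ → F)
    (hω : ∀ α β, sbr F (b α) (b β) = ω α β • b z) (s : κ × κ)
    (hcoc : ∀ α β γ, ω α β * Bc F p s z γ =
      ω β γ * Bc F p s α z - sg F (p α) (p β) * (ω α γ * Bc F p s β z))
    (a c : ZMod 2) (x y n : L) (hx : x ∈ grd F L a) (hy : y ∈ grd F L c) :
    Bf b p s (sbr F x y) n =
      Bf b p s x (sbr F y n) - sg F a c * Bf b p s y (sbr F x n) := by
  refine gr_ind b p hp a (fun x => Bf b p s (sbr F x y) n =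
      Bf b p s x (sbr F y n) - sg F a c * Bf b p s y (sbr F x n)) ?_ ?_ ?_ ?_ x hx
  · simp [Bf_zero_left, Bf_zero_right, sbr_zero_left]
  · intro x y h1 h2
    simp only [Bf_add_left, Bf_add_right, sbr_add_left, h1, h2]; ring
  · intro c x h
    simp only [Bf_smul_left, Bf_smul_right, sbr_smul_left, h]; ring
  intro α hα
  refine gr_ind b p hp c (fun y => Bf b p s (sbr F (b α) y) n =
      Bf b p s (b α) (sbr F y n) - sg F a c * Bf b p s y (sbr F (b α) n)) ?_ ?_ ?_ ?_ y hy
  · simp [Bf_zero_left, Bf_zero_right, sbr_zero_left, sbr_zero_right]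
  · intro x y h1 h2
    simp only [Bf_add_left, Bf_add_right, sbr_add_left, sbr_add_right, h1, h2]; ring
  · intro c x h
    simp only [Bf_smul_left, Bf_smul_right, sbr_smul_left, sbr_smul_right, h]; ring
  intro β hβ
  refine all_ind b (fun n => Bf b p s (sbr F (b α) (b β)) n =
      Bf b p s (b α) (sbr F (b β) n) - sg F a c * Bf b p s (b β) (sbr F (b α) n)) ?_ ?_ ?_ ?_ n
  · simp [Bf_zero_right, sbr_zero_right]
  · intro x y h1 h2
    simp only [Bf_add_right, sbr_add_right, h1, h2]; ring
  · intro c x h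
    simp only [Bf_smul_right, sbr_smul_right, h]; ring
  intro γ
  simp only [hω, Bf_smul_left, Bf_smul_right, Bf_basis]
  rw [hcoc, ← hα, ← hβ]

theorem sbr_in {L : Type v} [AddCommGroup L] [Module F L] [LieSuper F L]
    {κ : Type} [Fintype κ] (b : Basis κ F L) (z : κ) (ω : κ → κ → F)
    (hω : ∀ α β, sbr F (b α) (b β) = ω α β • b z) (x y : L) :
    ∃ c : F, sbr F x y = c • b z := by
  refine all_ind b (fun x => ∃ c : F, sbr F x y = c • b z) ?_ ?_ ?_ ?_ x
  · exact ⟨0, by simp [sbr_zero_left]⟩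
  · rintro x y ⟨c, h⟩ ⟨d, h'⟩; exact ⟨c + d, by rw [sbr_add_left, h, h', add_smul]⟩
  · rintro e x ⟨c, h⟩; exact ⟨e * c, by rw [sbr_smul_left, h, mul_smul]⟩
  intro α
  refine all_ind b (fun y => ∃ c : F, sbr F (b α) y = c • b z) ?_ ?_ ?_ ?_ y
  · exact ⟨0, by simp [sbr_zero_right]⟩
  · rintro x y ⟨c, h⟩ ⟨d, h'⟩; exact ⟨c + d, by rw [sbr_add_right, h, h', add_smul]⟩
  · rintro e x ⟨c, h⟩; exact ⟨e * c, by rw [sbr_smul_right, h, mul_smul]⟩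
  intro β
  exact ⟨_, hω α β⟩

theorem sg_id1 (a b c : ZMod 2) : sg F a (b + c) * sg F b (c + a) = sg F c (a + b) := by
  rcases zmod2_cases a with rfl | rfl <;> rcases zmod2_cases b with rfl | rfl <;>
    rcases zmod2_cases c with rfl | rfl <;>
    simp [sg_zero_left, sg_zero_right, sg_one_one, show (1 + 1 : ZMod 2) = 0 from rfl]

theorem sg_id2 (a b c : ZMod 2) :
    sg F a (b + c) * (sg F b c * sg F c (b + a)) = sg F a b := by
  rcases zmod2_cases a with rfl | rfl <;> rcases zmod2_cases b with rfl | rfl <;>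
    rcases zmod2_cases c with rfl | rfl <;>
    simp [sg_zero_left, sg_zero_right, sg_one_one, show (1 + 1 : ZMod 2) = 0 from rfl]

theorem qM_rel {L : Type v} [AddCommGroup L] [Module F L] [LieSuper F L]
    (hchar2 : (2 : F) ≠ 0)
    {κ : Type} [Fintype κ] [DecidableEq κ] (b : Basis κ F L) (p : κ → ZMod 2)
    (hp : ∀ α, b α ∈ grd F L (p α)) (z : κ) (ω : κ → κ → F)
    (hω : ∀ α β, sbr F (b α) (b β) = ω α β • b z) (S : Finset (κ × κ))
    (hS : ∀ α β, (α, β) ∈ S → (β, α) ∈ S → α = β ∧ p α = 1)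
    (hzz : (z, z) ∉ S)
    (hcoc : ∀ s ∈ S, ∀ α β γ, ω α β * Bc F p s z γ =
      ω β γ * Bc F p s α z - sg F (p α) (p β) * (ω α γ * Bc F p s β z)) :
    letI := absLS F (fun i : ULift.{v} ↥S => p i.down.1.1 + p i.down.1.2)
    ExtRel F (qM b p S) := by
  let _ := absLS F (fun i : ULift.{v} ↥S => p i.down.1.1 + p i.down.1.2)
  have hs1 : ∀ s ∈ S, s.1 = s.2 → p s.1 = 1 := by
    rintro ⟨α, β⟩ h1 h2
    simp only at h2
    subst h2
    exact (hS _ _ h1 h1).2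
  have halt : ∀ a c : ZMod 2, ∀ x ∈ grd F L a, ∀ y ∈ grd F L c,
      qM b p S x y = -(sg F a c) • qM b p S y x := by
    intro a c x hx y hy
    funext i
    exact Bf_alt b p hp _ (hs1 _ i.down.2) a c x y hx hy
  have hbl : ∀ a c : ZMod 2, ∀ x ∈ grd F L a, ∀ y ∈ grd F L c, ∀ n : L,
      qM b p S (sbr F x y) n = qM b p S x (sbr F y n) - sg F a c • qM b p S y (sbr F x n) := by
    intro a c x hx y hy n
    funext i
    exact Bc_cocycle b p hp z ω hω _ (hcoc _ i.down.2) a c x y n hx hy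
  refine ⟨⟨?_, ?_, ?_, ?_, ?_, hbl, ?_, ?_⟩, halt, ?_⟩
  · intro m m' n; funext i; exact Bf_add_left ..
  · intro m m' n; funext i; exact Bf_add_right ..
  · intro m m' n; funext i; exact Bf_smul_left ..
  · intro m m' n; funext i; exact Bf_smul_right ..
  · intro a c m hm n hn i hi
    exact Bf_grade b p hp _ a c m n hm hn hi
  · intro a b' c m hm n hn n' hn'
    rw [halt a (b' + c) m hm _ (sbr_mem b' c n n' hn hn'), hbl b' c n hn n' hn' m,
      halt b' (c + a) n hn _ (sbr_mem c a n' m hn' hm),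
      halt c (b' + a) n' hn' _ (sbr_mem b' a n m hn hm)]
    simp only [smul_sub, smul_smul]
    rw [← sg_id1 a b' c, ← sg_id2 a b' c]
    congr 2 <;> ring
  · intro a c m hm n hn m' n'
    obtain ⟨d, hd⟩ := sbr_in b z ω hω n m
    obtain ⟨e, he⟩ := sbr_in b z ω hω m' n'
    have h0 : qM b p S (sbr F n m) (sbr F m' n') = 0 := by
      funext i
      have : Bf b p i.down.1 (b z) (b z) = 0 := by
        rw [Bf_basis, Bc]
        have hi := i.down.2
        rw [if_neg, if_neg]
        · rintro ⟨h1, h2⟩; apply hzz; have h3 : (z, z) = i.down.1 := Prod.ext h2 h1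
          rw [h3]; exact hi
        · rintro ⟨h1, h2⟩; apply hzz; have h3 : (z, z) = i.down.1 := Prod.ext h1 h2
          rw [h3]; exact hi
      simp only [qM, hd, he, Bf_smul_left, Bf_smul_right, this]
      simp
    simp only [h0, smul_zero]
    rfl
  · intro x hx
    have h := halt 0 0 x hx x hx
    rw [sg_zero_left, neg_smul, one_smul] at h
    have h2 : (2 : F) • qM b p S x x = 0 := by
      rw [two_smul]; nth_rewrite 2 [h]; simp
    exact (smul_eq_zero.mp h2).resolve_left hchar2

theorem Bc_mem {κ : Type} [DecidableEq κ] (p : κ → ZMod 2) (S : Finset (κ × κ))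
    (hS : ∀ α β, (α, β) ∈ S → (β, α) ∈ S → α = β ∧ p α = 1)
    (α β : κ) (h : (α, β) ∈ S) (s : κ × κ) (hs : s ∈ S) :
    Bc F p s α β = if s = (α, β) then 1 else 0 := by
  obtain ⟨u, v⟩ := s
  unfold Bc
  by_cases h1 : α = u ∧ β = v
  · obtain ⟨rfl, rfl⟩ := h1; simp
  · have h2 : ¬ (α = v ∧ β = u) := by
      rintro ⟨rfl, rfl⟩
      exact h1 (by have := (hS _ _ h hs).1; exact ⟨this, this.symm⟩)
    have h3 : ¬ ((u, v) = (α, β)) := by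
      intro h; rw [Prod.mk.injEq] at h; exact h1 ⟨h.1.symm, h.2.symm⟩
    simp [h1, h2, h3]

theorem ext_lin {L : Type v} [AddCommGroup L] [Module F L] [LieSuper F L]
    {E : Type w} [AddCommGroup E] [Module F E] [LieSuper F E]
    {κ : Type} [Fintype κ] [DecidableEq κ] (b : Basis κ F L) (p : κ → ZMod 2)
    (hp : ∀ α, b α ∈ grd F L (p α)) (S : Finset (κ × κ))
    (hS : ∀ α β, (α, β) ∈ S → (β, α) ∈ S → α = β ∧ p α = 1)
    (t : L → L → E) (ht : ExtRel F t)
    (hvan : ∀ α β, (α, β) ∉ S → (β, α) ∉ S → t (b α) (b β) = 0) (x y : L) :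
    t x y = ∑ i : ULift.{v} ↥S, Bf b p i.down.1 x y • t (b i.down.1.1) (b i.down.1.2) := by
  have z1 : ∀ y, t 0 y = 0 := by
    intro y; have := ht.toTensor.smul_left 0 0 y; simpa using this
  have z2 : ∀ y, t y 0 = 0 := by
    intro y; have := ht.toTensor.smul_right 0 y 0; simpa using this
  refine all_ind b (fun x => t x y =
    ∑ i : ULift.{v} ↥S, Bf b p i.down.1 x y • t (b i.down.1.1) (b i.down.1.2)) ?_ ?_ ?_ ?_ x
  · simp [z1, Bf_zero_left]
  · intro x x' h1 h2
    simp only [ht.toTensor.add_left, h1, h2, Bf_add_left, add_smul, Finset.sum_add_distrib]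
  · intro c x h
    simp only [ht.toTensor.smul_left, h, Bf_smul_left, mul_smul, Finset.smul_sum]
  intro α
  refine all_ind b (fun y => t (b α) y =
    ∑ i : ULift.{v} ↥S, Bf b p i.down.1 (b α) y • t (b i.down.1.1) (b i.down.1.2)) ?_ ?_ ?_ ?_ y
  · simp [z2, Bf_zero_right]
  · intro x x' h1 h2
    simp only [ht.toTensor.add_right, h1, h2, Bf_add_right, add_smul, Finset.sum_add_distrib]
  · intro c x h
    simp only [ht.toTensor.smul_right, h, Bf_smul_right, mul_smul, Finset.smul_sum]
  intro β
  have key : ∀ α β, (α, β) ∈ S → t (b α) (b β) =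
      ∑ i : ULift.{v} ↥S, Bf b p i.down.1 (b α) (b β) • t (b i.down.1.1) (b i.down.1.2) := by
    intro α β h
    rw [Finset.sum_eq_single (ULift.up ⟨(α, β), h⟩)]
    · rw [Bf_basis, Bc_mem p S hS α β h _ h]; simp
    · rintro ⟨⟨s, hs⟩⟩ _ hne
      rw [Bf_basis, Bc_mem p S hS α β h _ hs, if_neg, zero_smul]
      rintro rfl; exact hne rfl
    · simp
  by_cases h : (α, β) ∈ S
  · exact key α β h
  by_cases h' : (β, α) ∈ S
  · rw [ht.alt _ _ _ (hp α) _ (hp β), key β α h', Finset.smul_sum]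
    refine Finset.sum_congr rfl fun i _ => ?_
    rw [smul_smul, Bf_alt b p hp i.down.1 ?_ _ _ _ _ (hp α) (hp β)]
    intro h; exact (hS _ _ i.down.2 (by rw [← h]; nth_rewrite 2 [h]; exact i.down.2)).2
  · rw [hvan α β h h', Finset.sum_eq_zero]
    rintro ⟨⟨⟨u, v⟩, hs⟩⟩ _
    rw [Bf_basis, Bc, if_neg, if_neg, zero_smul]
    · rintro ⟨rfl, rfl⟩; exact h' hs
    · rintro ⟨rfl, rfl⟩; exact h hs

theorem key_thm (hchar2 : (2 : F) ≠ 0) (H E : LieSupAlg.{u, v} F)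
    (t : H.carrier → H.carrier → E.carrier) (ht : IsExtObj F t)
    {κ : Type} [Fintype κ] [DecidableEq κ] (b : Basis κ F H.carrier) (p : κ → ZMod 2)
    (hp : ∀ α, b α ∈ grd F H.carrier (p α)) (z : κ) (ω : κ → κ → F)
    (hω : ∀ α β, sbr F (b α) (b β) = ω α β • b z) (S : Finset (κ × κ))
    (hS : ∀ α β, (α, β) ∈ S → (β, α) ∈ S → α = β ∧ p α = 1)
    (hzz : (z, z) ∉ S)
    (hcoc : ∀ s ∈ S, ∀ α β γ, ω α β * Bc F p s z γ =
      ω β γ * Bc F p s α z - sg F (p α) (p β) * (ω α γ * Bc F p s β z))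
    (hvan : ∀ α β, (α, β) ∉ S → (β, α) ∉ S → t (b α) (b β) = 0) :
    IsAbelSuper F (S.filter fun s => p s.1 + p s.2 = 0).card
      (S.filter fun s => p s.1 + p s.2 = 1).card E.carrier := by
  let ι := ULift.{v} ↥S
  let pι : ι → ZMod 2 := fun i => p i.down.1.1 + p i.down.1.2
  let iV : LieSuper F (ι → F) := absLS F pι
  let iU : LieSuper F (ULift.{u} E.carrier) := ulLS F E.carrier
  have hq : ExtRel F (qM b p S) := qM_rel hchar2 b p hp z ω hω S hS hzz hcoc
  obtain ⟨h, ⟨hh, hht⟩, -⟩ := ht.lift ⟨ι → F⟩ (qM b p S) hq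
  change E.carrier →ₗ[F] (ι → F) at h
  let g : (ι → F) →ₗ[F] E.carrier :=
    Fintype.linearCombination F (fun i : ι => t (b i.down.1.1) (b i.down.1.2))
  have hg : ∀ x y, g (qM b p S x y) = t x y := by
    intro x y
    rw [ext_lin b p hp S hS t ht.rel hvan x y]
    rfl
  -- brackets vanish on t
  have htt : ∀ i j : ι, sbr F (t (b i.down.1.1) (b i.down.1.2)) (t (b j.down.1.1) (b j.down.1.2))
      = 0 := by
    intro i j
    rw [ht.rel.toTensor.brk_brk _ _ _ (hp _) _ (hp _)]
    simp only [hω, ht.rel.toTensor.smul_left, ht.rel.toTensor.smul_right, hvan z z hzz hzz,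
      smul_zero]
  have hgsum : ∀ f : ι → F, g f = ∑ i, f i • t (b i.down.1.1) (b i.down.1.2) := fun f => rfl
  have hgb : ∀ f f', sbr F (g f) (g f') = 0 := by
    intro f f'
    rw [hgsum f]
    refine Finset.sum_induction _ (fun x => sbr F x (g f') = 0) ?_ (sbr_zero_left _) ?_
    · intro x y h1 h2; rw [sbr_add_left, h1, h2, add_zero]
    intro i _
    rw [sbr_smul_left, hgsum f']
    refine smul_eq_zero_of_right _ ?_
    refine Finset.sum_induction _ (fun x => sbr F _ x = 0) ?_ (sbr_zero_right _) ?_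
    · intro x y h1 h2; rw [sbr_add_right, h1, h2, add_zero]
    intro j _
    rw [sbr_smul_right, htt, smul_zero]
  have hgg : ∀ a : ZMod 2, ∀ f ∈ grd F (ι → F) a, g f ∈ grd F E.carrier a := by
    intro a f hf
    rw [hgsum f]
    refine Submodule.sum_mem _ fun i _ => ?_
    by_cases hi : pι i = a
    · exact Submodule.smul_mem _ _ (hi ▸ ht.rel.toTensor.grade _ _ _ (hp _) _ (hp _))
    · rw [hf i hi, zero_smul]; exact Submodule.zero_mem _
  have hrelU : ExtRel F (fun x y => (ULift.up (t x y) : ULift.{u} E.carrier)) := by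
    have r := ht.rel
    refine ⟨⟨?_, ?_, ?_, ?_, ?_, ?_, ?_, ?_⟩, ?_, ?_⟩
    · intro x y w; exact congrArg ULift.up (r.toTensor.add_left x y w)
    · intro x y w; exact congrArg ULift.up (r.toTensor.add_right x y w)
    · intro x y w; exact congrArg ULift.up (r.toTensor.smul_left x y w)
    · intro x y w; exact congrArg ULift.up (r.toTensor.smul_right x y w)
    · intro a c x hx y hy; exact r.toTensor.grade a c x hx y hy
    · intro a c x hx y hy n; exact congrArg ULift.up (r.toTensor.brk_left a c x hx y hy n)
    · intro a c d x hx y hy n hn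
      exact congrArg ULift.up (r.toTensor.brk_right a c d x hx y hy n hn)
    · intro a c x hx y hy n n'
      exact congrArg ULift.up (r.toTensor.brk_brk a c x hx y hy n n')
    · intro a c x hx y hy; exact congrArg ULift.up (r.alt a c x hx y hy)
    · intro x hx; exact congrArg ULift.up (r.alt_even x hx)
  have hgh : ∀ e, g (h e) = e := by
    have hu := (ht.lift ⟨ULift.{u} E.carrier⟩ _ hrelU).unique
      (y₁ := (ULift.moduleEquiv (R := F) (M := E.carrier)).symm.toLinearMap ∘ₗ g ∘ₗ h)
      (y₂ := (ULift.moduleEquiv (R := F) (M := E.carrier)).symm.toLinearMap) ?_ ?_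
    · intro e
      have := congrArg (fun f => ULift.down (f e)) hu
      exact this
    · refine ⟨⟨?_, ?_⟩, ?_⟩
      · intro a x hx
        exact hgg a _ (hh.1 a x hx)
      · intro x y
        have h1 : h (sbr F x y) = 0 := hh.2 x y
        have h2 := hgb (h x) (h y)
        refine congrArg ULift.up (?_ : g (h (sbr F x y)) = sbr F (g (h x)) (g (h y)))
        rw [h1, h2, map_zero]
      · intro x y
        refine congrArg ULift.up (?_ : g (h (t x y)) = t x y)
        exact (congrArg g (hht x y)).trans (hg x y)
    · refine ⟨⟨?_, ?_⟩, ?_⟩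
      · intro a x hx; exact hx
      · intro x y; rfl
      · intro x y; rfl
  have hhg : ∀ f, h (g f) = f := by
    intro f
    rw [hgsum f, map_sum]
    funext j
    rw [Finset.sum_apply, Finset.sum_eq_single j]
    · rw [map_smul, hht]
      simp only [Pi.smul_apply, qM, Bf_basis, smul_eq_mul]
      rw [Bc_mem p S hS _ _ j.down.2 _ j.down.2]; simp
    · intro i _ hij
      rw [map_smul, hht]
      simp only [Pi.smul_apply, qM, Bf_basis, smul_eq_mul]
      rw [Bc_mem p S hS _ _ i.down.2 _ j.down.2, if_neg, mul_zero]
      intro h'; apply hij; exact ULift.ext _ _ (Subtype.ext h'.symm)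
    · simp
  let e : E.carrier ≃ₗ[F] (ι → F) := LinearEquiv.ofLinearMap h g
    (LinearMap.ext hhg) (LinearMap.ext hgh)
  have hfin : ∀ a : ZMod 2, Module.finrank F ↥(grd F E.carrier a) =
      (S.filter fun s => p s.1 + p s.2 = a).card := by
    intro a
    have h1 : (grd F E.carrier a).map e.toLinearMap = (absLS F pι).gr a := by
      ext f
      constructor
      · rintro ⟨x, hx, rfl⟩
        exact hh.1 a x hx
      · intro hf
        exact ⟨g f, hgg a f hf, hhg f⟩
    rw [← LinearEquiv.finrank_map_eq e, h1, finrank_abs, ← Fintype.card_coe]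
    refine Fintype.card_congr ⟨fun i => ⟨i.1.down.1, ?_⟩, fun s => ⟨⟨s.1, ?_⟩, ?_⟩, ?_, ?_⟩
    · exact Finset.mem_filter.mpr ⟨i.1.down.2, i.2⟩
    · exact (Finset.mem_filter.mp s.2).1
    · exact (Finset.mem_filter.mp s.2).2
    · intro i; rfl
    · intro i; rfl
  refine ⟨?_, ?_, hfin 0, hfin 1⟩
  · intro x y
    rw [← hgh x, ← hgh y, hgb]
  · exact Module.Finite.equiv e.symm

/-- surviving pairs -/
def Sp (k n : ℕ) (e : Bool) : Fin k ⊕ (Fin n ⊕ Unit) → Fin k ⊕ (Fin n ⊕ Unit) → Bool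
  | Sum.inl i, Sum.inl j => decide (i < j)
  | Sum.inl _, Sum.inr (Sum.inl _) => true
  | Sum.inl _, Sum.inr (Sum.inr _) => e
  | Sum.inr (Sum.inl i), Sum.inr (Sum.inl j) => decide (i ≤ j)
  | Sum.inr (Sum.inl _), Sum.inl _ => false
  | Sum.inr (Sum.inl _), Sum.inr (Sum.inr _) => false
  | Sum.inr (Sum.inr _), _ => false

/-- parity -/
def par (k n : ℕ) (pz : ZMod 2) : Fin k ⊕ (Fin n ⊕ Unit) → ZMod 2
  | Sum.inl _ => 0
  | Sum.inr (Sum.inl _) => 1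
  | Sum.inr (Sum.inr _) => pz

/-- the set of surviving pairs -/
def SS (k n : ℕ) (e : Bool) :
    Finset ((Fin k ⊕ (Fin n ⊕ Unit)) × (Fin k ⊕ (Fin n ⊕ Unit))) :=
  Finset.univ.filter fun s => Sp k n e s.1 s.2 = true

theorem sum_le (n : ℕ) : (∑ i : Fin n, ∑ j : Fin n, if i ≤ j then 1 else 0) = n * (n + 1) / 2 := by
  have h : (∑ i : Fin n, ∑ j : Fin n, if i ≤ j then 1 else 0) = ∑ j ∈ Finset.range (n + 1), j := by
    rw [Finset.sum_comm, Finset.sum_range_succ', ← Fin.sum_univ_eq_sum_range (fun j => j + 1)]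
    simp only [add_zero]
    refine Finset.sum_congr rfl fun j _ => ?_
    rw [← Finset.card_filter]
    have : (Finset.univ.filter fun i : Fin n => i ≤ j) = Finset.Iic j := by ext; simp
    rw [this, Fin.card_Iic]
  rw [h, Finset.sum_range_id, Nat.add_sub_cancel, mul_comm]

theorem sum_lt (n : ℕ) : (∑ i : Fin n, ∑ j : Fin n, if i < j then 1 else 0) = n * (n - 1) / 2 := by
  have h : (∑ i : Fin n, ∑ j : Fin n, if i < j then 1 else 0) = ∑ j ∈ Finset.range n, j := by
    rw [Finset.sum_comm, ← Fin.sum_univ_eq_sum_range (fun j => j)]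
    refine Finset.sum_congr rfl fun j _ => ?_
    rw [← Finset.card_filter]
    have : (Finset.univ.filter fun i : Fin n => i < j) = Finset.Iio j := by ext; simp
    rw [this, Fin.card_Iio]
  rw [h, Finset.sum_range_id]

theorem card0 (k n : ℕ) (e : Bool) (pz : ZMod 2) :
    ((SS k n e).filter fun s => par k n pz s.1 + par k n pz s.2 = 0).card =
      k * (k - 1) / 2 + n * (n + 1) / 2 + (if e = true ∧ pz = 0 then k else 0) := by
  rw [SS, Finset.filter_filter, Finset.card_filter, Fintype.sum_prod_type]
  simp only [Fintype.sum_sum_type, Sp, par, show (1 + 1 : ZMod 2) = 0 from rfl]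
  simp only [decide_eq_true_eq, add_zero, zero_add, and_true, true_and, one_ne_zero, if_false,
    Bool.false_eq_true, false_and, Finset.sum_const_zero, Finset.sum_add_distrib, sum_le, sum_lt]
  split_ifs <;> simp <;> ring

theorem card1 (k n : ℕ) (e : Bool) (pz : ZMod 2) :
    ((SS k n e).filter fun s => par k n pz s.1 + par k n pz s.2 = 1).card =
      k * n + (if e = true ∧ pz = 1 then k else 0) := by
  rw [SS, Finset.filter_filter, Finset.card_filter, Fintype.sum_prod_type]
  simp only [Fintype.sum_sum_type, Sp, par, show (1 + 1 : ZMod 2) = 0 from rfl]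
  simp only [decide_eq_true_eq, add_zero, zero_add, and_true, true_and, zero_ne_one, if_false,
    Bool.false_eq_true, false_and, and_false, Finset.sum_const_zero, Finset.sum_add_distrib]
  split_ifs <;> simp

theorem SS_symm (k n : ℕ) (e : Bool) (pz : ZMod 2) (α β : Fin k ⊕ (Fin n ⊕ Unit))
    (h1 : (α, β) ∈ SS k n e) (h2 : (β, α) ∈ SS k n e) : α = β ∧ par k n pz α = 1 := by
  simp only [SS, Finset.mem_filter, Finset.mem_univ, true_and] at h1 h2
  rcases α with i | i | i <;> rcases β with j | j | j <;>
    simp only [Sp, decide_eq_true_eq, Bool.false_eq_true] at h1 h2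
  · exact absurd h1 (not_lt.mpr h2.le)
  · exact ⟨by rw [le_antisymm h1 h2], rfl⟩

theorem heis_gen (hchar2 : (2 : F) ≠ 0) (k n : ℕ) (e : Bool) (pz : ZMod 2)
    (H E : LieSupAlg.{u, v} F)
    (t : H.carrier → H.carrier → E.carrier) (ht : IsExtObj F t)
    (x : Fin k → H.carrier) (y : Fin n → H.carrier) (z : H.carrier)
    (hx : ∀ i, x i ∈ grd F H.carrier 0) (hy : ∀ i, y i ∈ grd F H.carrier 1)
    (hz : z ∈ grd F H.carrier pz)
    (li : LinearIndependent F (Sum.elim x (Sum.elim y (fun _ : Unit => z))))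
    (sp : Submodule.span F (Set.range (Sum.elim x (Sum.elim y (fun _ : Unit => z)))) = ⊤)
    (ω : Fin k ⊕ (Fin n ⊕ Unit) → Fin k ⊕ (Fin n ⊕ Unit) → F)
    (hω : ∀ α β, sbr F (Sum.elim x (Sum.elim y (fun _ : Unit => z)) α)
      (Sum.elim x (Sum.elim y (fun _ : Unit => z)) β) = ω α β • z)
    (hcoc : e = true → ∀ i : Fin k, ∀ α β γ,
      ω α β * Bc F (par k n pz) (Sum.inl i, Sum.inr (Sum.inr ())) (Sum.inr (Sum.inr ())) γ =
      ω β γ * Bc F (par k n pz) (Sum.inl i, Sum.inr (Sum.inr ())) α (Sum.inr (Sum.inr ()))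
       - sg F (par k n pz α) (par k n pz β) *
        (ω α γ * Bc F (par k n pz) (Sum.inl i, Sum.inr (Sum.inr ())) β (Sum.inr (Sum.inr ()))))
    (hvx : e = false → ∀ i, t z (x i) = 0) (hvy : ∀ i, t z (y i) = 0) (hvz : t z z = 0) :
    IsAbelSuper F (k * (k - 1) / 2 + n * (n + 1) / 2 + (if e = true ∧ pz = 0 then k else 0))
      (k * n + (if e = true ∧ pz = 1 then k else 0)) E.carrier := by
  rw [← card0 k n e pz, ← card1 k n e pz]
  let b : Basis (Fin k ⊕ (Fin n ⊕ Unit)) F H.carrier := Basis.mk li sp.ge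
  have hb : ⇑b = Sum.elim x (Sum.elim y (fun _ : Unit => z)) := Basis.coe_mk _ _
  have hp : ∀ α, b α ∈ grd F H.carrier (par k n pz α) := by
    rw [hb]; rintro (i | i | i)
    · exact hx i
    · exact hy i
    · exact hz
  have hsw : ∀ α β, t (b α) (b β) = 0 → t (b β) (b α) = 0 := by
    intro α β h
    rw [ht.rel.alt _ _ _ (hp β) _ (hp α), h, smul_zero]
  refine key_thm hchar2 H E t ht b (par k n pz) hp (Sum.inr (Sum.inr ())) ω ?_ (SS k n e) ?_ ?_ ?_ ?_
  · rw [hb]; exact hω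
  · exact SS_symm k n e pz
  · intro h
    simp only [SS, Finset.mem_filter, Finset.mem_univ, true_and] at h
    simp [Sp] at h
  · rintro ⟨α, β⟩ hs
    simp only [SS, Finset.mem_filter, Finset.mem_univ, true_and] at hs
    rcases α with i | i | i <;> rcases β with j | j | j <;> try (simp [Sp] at hs; done)
    · intro α β γ; simp [Bc]
    · intro α β γ; simp [Bc]
    · exact hcoc hs i
    · intro α β γ; simp [Bc]
  · intro α β h1 h2
    simp only [SS, Finset.mem_filter, Finset.mem_univ, true_and] at h1 h2
    rcases α with i | i | i <;> rcases β with j | j | j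
    · simp only [Sp, decide_eq_true_eq, not_lt] at h1 h2
      rw [le_antisymm h2 h1]
      exact ht.rel.alt_even _ (hp (Sum.inl j))
    · simp [Sp] at h1
    · apply hsw; rw [hb]; exact hvx (by simpa [Sp] using h1) i
    · simp [Sp] at h2
    · simp only [Sp, decide_eq_true_eq, not_le] at h1 h2
      exact absurd h1 (not_lt.mpr h2.le)
    · apply hsw; rw [hb]; exact hvy i
    · rw [hb]; exact hvx (by simpa [Sp] using h2) j
    · rw [hb]; exact hvy j
    · rw [hb]; exact hvz

theorem van {L : Type v} {E : Type w} [AddCommGroup L] [Module F L] [LieSuper F L]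
    [AddCommGroup E] [Module F E] [LieSuper F E] (t : L → L → E) (ht : ExtRel F t)
    (a c : ZMod 2) (x y z w : L) (hx : x ∈ grd F L a) (hy : y ∈ grd F L c)
    (hz : sbr F x y = z) (h1 : sbr F x w = 0) (h2 : sbr F y w = 0) : t z w = 0 := by
  have z2 : ∀ y, t y 0 = 0 := by
    intro y; have := ht.toTensor.smul_right 0 y 0; simpa using this
  rw [← hz, ht.toTensor.brk_left a c x hx y hy]
  simp only [h1, h2, z2, smul_zero, sub_zero]

/-- structure constants, even center -/
def omE (F : Type u) [Field F] (m n : ℕ) :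
    Fin (2 * m) ⊕ (Fin n ⊕ Unit) → Fin (2 * m) ⊕ (Fin n ⊕ Unit) → F
  | Sum.inl i, Sum.inl j =>
    if (j : ℕ) = (i : ℕ) + m then 1 else if (i : ℕ) = (j : ℕ) + m then -1 else 0
  | Sum.inr (Sum.inl i), Sum.inr (Sum.inl j) => if i = j then 1 else 0
  | _, _ => 0

/-- structure constants, odd center -/
def omO (F : Type u) [Field F] (m : ℕ) :
    Fin m ⊕ (Fin m ⊕ Unit) → Fin m ⊕ (Fin m ⊕ Unit) → F
  | Sum.inl i, Sum.inr (Sum.inl j) => if i = j then 1 else 0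
  | Sum.inr (Sum.inl j), Sum.inl i => if i = j then -1 else 0
  | _, _ => 0

theorem heisE_gen (hchar2 : (2 : F) ≠ 0) (m n : ℕ) (e : Bool)
    (H E : LieSupAlg.{u, v} F)
    (t : H.carrier → H.carrier → E.carrier) (ht : IsExtObj F t)
    (x : Fin (2 * m) → H.carrier) (y : Fin n → H.carrier) (z : H.carrier)
    (hx : ∀ i, x i ∈ grd F H.carrier 0) (hz : z ∈ grd F H.carrier 0)
    (hy : ∀ i, y i ∈ grd F H.carrier 1)
    (li : LinearIndependent F (Sum.elim x (Sum.elim y (fun _ : Unit => z))))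
    (sp : Submodule.span F (Set.range (Sum.elim x (Sum.elim y (fun _ : Unit => z)))) = ⊤)
    (hxx : ∀ i j : Fin (2 * m), sbr F (x i) (x j) =
      if (j : ℕ) = (i : ℕ) + m then z else if (i : ℕ) = (j : ℕ) + m then -z else 0)
    (hxy : ∀ (i : Fin (2 * m)) (j : Fin n), sbr F (x i) (y j) = 0)
    (hyx : ∀ (i : Fin (2 * m)) (j : Fin n), sbr F (y j) (x i) = 0)
    (hyy : ∀ i j : Fin n, sbr F (y i) (y j) = if i = j then z else 0)
    (hzw : ∀ w, sbr F z w = 0) (hwz : ∀ w, sbr F w z = 0)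
    (hmn : e = true → m = 1 ∧ n = 0)
    (hvx : e = false → ∀ i, t z (x i) = 0) (hvy : ∀ i, t z (y i) = 0) :
    IsAbelSuper F (2 * m * (2 * m - 1) / 2 + n * (n + 1) / 2 + (if e = true then 2 * m else 0))
      (2 * m * n) E.carrier := by
  have := heis_gen hchar2 (2 * m) n e 0 H E t ht x y z hx hy hz li sp (omE F m n) ?_ ?_ hvx hvy
    (ht.rel.alt_even z hz)
  · simpa using this
  · rintro (i | i | i) (j | j | j) <;> simp only [Sum.elim_inl, Sum.elim_inr, omE, hxx, hxy, hyx,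
      hyy, hzw, hwz, zero_smul]
    · split_ifs <;> simp
    · split_ifs <;> simp
  · intro he
    obtain ⟨rfl, rfl⟩ := hmn he
    intro i
    rintro (α | α | α) (β | β | β) (γ | γ | γ) <;>
      first
      | exact α.elim0
      | exact β.elim0
      | exact γ.elim0
      | skip
    all_goals simp only [omE, Bc, par, sg_zero_left]
    all_goals try simp
    all_goals
      fin_cases i <;> fin_cases α <;> fin_cases β <;> simp
    all_goals fin_cases γ <;> simp

theorem heisO_gen (hchar2 : (2 : F) ≠ 0) (m : ℕ) (e : Bool)
    (H E : LieSupAlg.{u, v} F)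
    (t : H.carrier → H.carrier → E.carrier) (ht : IsExtObj F t) (hm : 1 ≤ m)
    (x : Fin m → H.carrier) (y : Fin m → H.carrier) (z : H.carrier)
    (hx : ∀ i, x i ∈ grd F H.carrier 0)
    (hy : ∀ i, y i ∈ grd F H.carrier 1) (hz : z ∈ grd F H.carrier 1)
    (li : LinearIndependent F (Sum.elim x (Sum.elim y (fun _ : Unit => z))))
    (sp : Submodule.span F (Set.range (Sum.elim x (Sum.elim y (fun _ : Unit => z)))) = ⊤)
    (hxx : ∀ i j : Fin m, sbr F (x i) (x j) = 0)
    (hxy : ∀ i j : Fin m, sbr F (x i) (y j) = if i = j then z else 0)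
    (hyx : ∀ i j : Fin m, sbr F (y j) (x i) = if i = j then -z else 0)
    (hyy : ∀ i j : Fin m, sbr F (y i) (y j) = 0)
    (hzw : ∀ w, sbr F z w = 0) (hwz : ∀ w, sbr F w z = 0)
    (hmn : e = true → m = 1)
    (hvx : e = false → ∀ i, t z (x i) = 0) (hvy : ∀ i, t z (y i) = 0) :
    IsAbelSuper F (m * (m - 1) / 2 + m * (m + 1) / 2)
      (m * m + (if e = true then m else 0)) E.carrier := by
  have hvz : t z z = 0 := van t ht.rel 0 1 (x ⟨0, hm⟩) (y ⟨0, hm⟩) z z (hx _) (hy _)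
    (by rw [hxy, if_pos rfl]) (hwz _) (hwz _)
  have := heis_gen hchar2 m m e 1 H E t ht x y z hx hy hz li sp (omO F m) ?_ ?_ hvx hvy hvz
  · simpa using this
  · rintro (i | i | i) (j | j | j) <;> simp only [Sum.elim_inl, Sum.elim_inr, omO, hxx, hxy, hyx,
      hyy, hzw, hwz, zero_smul]
    · split_ifs <;> simp
    · split_ifs <;> simp
  · intro he
    obtain rfl := hmn he
    intro i
    obtain rfl := Subsingleton.elim i 0
    rintro (α | α | α) (β | β | β) (γ | γ | γ) <;>
      simp [omO, Bc, par, sg_zero_left, sg_zero_right, Subsingleton.elim _ (0 : Fin 1)]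

end aux

/-- exterior squares of Heisenberg Lie superalgebras:
(1) `H(1,0) ∧ H(1,0) ≅ A(3|0)`; (2) `H(0,1) ∧ H(0,1) ≅ A(1|0)`;
(3) for `m + n ≥ 2`, `H(m,n) ∧ H(m,n) ≅ A(r|s)` with `r = 2m² − m + n(n+1)/2`
and `s = 2mn`; (4) `H₁ ∧ H₁ ≅ A(1|2)`; (5) for `m ≥ 2`, `H_m ∧ H_m ≅ A(m²|m²)`. -/
theorem exterior_square_of_heisenberg (F : Type u) [Field F]
    (hchar2 : (2 : F) ≠ 0) (hchar3 : (3 : F) ≠ 0) :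
    (∀ (H E : LieSupAlg.{u, v} F) (t : H.carrier → H.carrier → E.carrier),
      IsHeisE F 1 0 H.carrier → IsExtObj F t → IsAbelSuper F 3 0 E.carrier) ∧
    (∀ (H E : LieSupAlg.{u, v} F) (t : H.carrier → H.carrier → E.carrier),
      IsHeisE F 0 1 H.carrier → IsExtObj F t → IsAbelSuper F 1 0 E.carrier) ∧
    (∀ (m n : ℕ), 2 ≤ m + n →
      ∀ (H E : LieSupAlg.{u, v} F) (t : H.carrier → H.carrier → E.carrier),
      IsHeisE F m n H.carrier → IsExtObj F t →
      IsAbelSuper F (2 * m ^ 2 - m + n * (n + 1) / 2) (2 * m * n) E.carrier) ∧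
    (∀ (H E : LieSupAlg.{u, v} F) (t : H.carrier → H.carrier → E.carrier),
      IsHeisO F 1 H.carrier → IsExtObj F t → IsAbelSuper F 1 2 E.carrier) ∧
    (∀ (m : ℕ), 2 ≤ m →
      ∀ (H E : LieSupAlg.{u, v} F) (t : H.carrier → H.carrier → E.carrier),
      IsHeisO F m H.carrier → IsExtObj F t →
      IsAbelSuper F (m ^ 2) (m ^ 2) E.carrier) := by
  refine ⟨?_, ?_, ?_, ?_, ?_⟩
  · rintro H E t ⟨x, y, z, hx, hz, hy, li, sp, hxx, hxy, hyx, hyy, hzw, hwz⟩ ht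
    have := heisE_gen hchar2 1 0 true H E t ht x y z hx hz hy li sp hxx hxy hyx hyy hzw hwz
      (by simp) (by simp) (fun i => i.elim0)
    simpa using this
  · rintro H E t ⟨x, y, z, hx, hz, hy, li, sp, hxx, hxy, hyx, hyy, hzw, hwz⟩ ht
    have := heisE_gen hchar2 0 1 false H E t ht x y z hx hz hy li sp hxx hxy hyx hyy hzw hwz
      (by simp) (fun _ i => i.elim0) ?_
    · simpa using this
    · intro i
      have h1 := ht.rel.toTensor.brk_left 1 1 (y i) (hy i) (y i) (hy i) (y i)
      have h2 := ht.rel.alt 1 0 (y i) (hy i) z hz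
      simp only [hyy, if_true, sg_one_one] at h1
      rw [sg_zero_right, neg_one_smul] at h2
      rw [h2, neg_one_smul, sub_neg_eq_add] at h1
      have h3 : (3 : F) • t z (y i) = 0 := by
        have : (3 : F) • t z (y i) = t z (y i) + (t z (y i) + t z (y i)) := by
          rw [show (3 : F) = 1 + (1 + 1) by norm_num, add_smul, add_smul, one_smul]
        rw [this]; nth_rewrite 1 [h1]; abel
      exact (smul_eq_zero.mp h3).resolve_left hchar3
  · rintro m n hmn H E t ⟨x, y, z, hx, hz, hy, li, sp, hxx, hxy, hyx, hyy, hzw, hwz⟩ ht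
    have := heisE_gen hchar2 m n false H E t ht x y z hx hz hy li sp hxx hxy hyx hyy hzw hwz
      (by simp) ?_ ?_
    · have hc : 2 * m * (2 * m - 1) / 2 = 2 * m ^ 2 - m := by
        rw [mul_assoc, Nat.mul_div_cancel_left _ (by norm_num), Nat.mul_sub, mul_one]
        congr 1; ring
      rw [hc] at this
      simpa using this
    · intro _ i
      by_cases hn : 0 < n
      · exact van t ht.rel 1 1 (y ⟨0, hn⟩) (y ⟨0, hn⟩) z _ (hy _) (hy _) (by simp [hyy])
          (hyx _ _) (hyx _ _)
      · obtain ⟨j, hj, hj1, hj2⟩ : ∃ j, j < m ∧ (i : ℕ) ≠ j ∧ (i : ℕ) ≠ j + m := by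
          by_cases h : (i : ℕ) = 0 ∨ (i : ℕ) = m
          · exact ⟨1, by omega, by omega, by omega⟩
          · exact ⟨0, by omega, by omega, by omega⟩
        refine van t ht.rel 0 0 (x ⟨j, by omega⟩) (x ⟨j + m, by omega⟩) z _ (hx _) (hx _)
          (by simp [hxx]) ?_ ?_
        · rw [hxx, if_neg, if_neg]
          · simp only; have := i.2; omega
          · simpa using hj2
        · rw [hxx, if_neg, if_neg]
          · simp only; omega
          · simp only; have := i.2; omega
    · intro i
      by_cases hm : 0 < m
      · exact van t ht.rel 0 0 (x ⟨0, by omega⟩) (x ⟨0 + m, by omega⟩) z _ (hx _) (hx _)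
          (by simp [hxx]) (hxy _ _) (hxy _ _)
      · obtain ⟨j, hj, hj1⟩ : ∃ j, j < n ∧ j ≠ (i : ℕ) := by
          by_cases h : (i : ℕ) = 0
          · exact ⟨1, by omega, by omega⟩
          · exact ⟨0, by omega, by omega⟩
        have hji : sbr F (y ⟨j, hj⟩) (y i) = 0 := by
          rw [hyy, if_neg]; intro h; exact hj1 (congrArg Fin.val h)
        exact van t ht.rel 1 1 (y ⟨j, hj⟩) (y ⟨j, hj⟩) z _ (hy _) (hy _) (by simp [hyy]) hji hji
  · rintro H E t ⟨x, y, z, hx, hy, hz, li, sp, hxx, hxy, hyx, hyy, hzw, hwz⟩ ht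
    have := heisO_gen hchar2 1 true H E t ht le_rfl x y z hx hy hz li sp hxx hxy hyx hyy hzw hwz
      (by simp) (by simp) ?_
    · simpa using this
    · intro i
      have h1 := ht.rel.toTensor.brk_left 0 1 (x i) (hx i) (y i) (hy i) (y i)
      have h2 := ht.rel.alt 1 1 (y i) (hy i) z hz
      have z2 : ∀ y, t y 0 = 0 := by
        intro y; have := ht.rel.toTensor.smul_right 0 y 0; simpa using this
      simp only [hyy, hxy, if_true, sg_zero_left, z2, one_smul, zero_sub] at h1
      rw [sg_one_one, neg_neg, one_smul] at h2
      rw [h2] at h1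
      have h3 : (2 : F) • t z (y i) = 0 := by
        rw [two_smul]; nth_rewrite 1 [h1]; simp
      exact (smul_eq_zero.mp h3).resolve_left hchar2
  · rintro m hm H E t ⟨x, y, z, hx, hy, hz, li, sp, hxx, hxy, hyx, hyy, hzw, hwz⟩ ht
    have hex : ∀ i : Fin m, ∃ j : Fin m, j ≠ i := by
      intro i
      by_cases h : (i : ℕ) = 0
      · exact ⟨⟨1, by omega⟩, fun h' => by have := congrArg Fin.val h'; simp at this; omega⟩
      · exact ⟨⟨0, by omega⟩, fun h' => by have := congrArg Fin.val h'; simp at this; omega⟩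
    have := heisO_gen hchar2 m false H E t ht (by omega) x y z hx hy hz li sp hxx hxy hyx hyy
      hzw hwz (by simp) ?_ ?_
    · have hc : m * (m - 1) / 2 + m * (m + 1) / 2 = m ^ 2 := by
        obtain ⟨k, rfl⟩ : ∃ k, m = k + 1 := ⟨m - 1, by omega⟩
        have h1 : 2 ∣ (k + 1) * (k + 1 - 1) := by
          rw [Nat.add_sub_cancel, mul_comm]; exact (Nat.even_mul_succ_self k).two_dvd
        have h2 : 2 ∣ (k + 1) * (k + 1 + 1) := (Nat.even_mul_succ_self (k + 1)).two_dvd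
        rw [← Nat.add_div_of_dvd_right h1, Nat.add_sub_cancel]
        apply Nat.div_eq_of_eq_mul_right (by norm_num)
        ring
      rw [hc] at this
      simpa [pow_two] using this
    · intro _ i
      obtain ⟨j, hj⟩ := hex i
      exact van t ht.rel 0 1 (x j) (y j) z _ (hx _) (hy _) (by simp [hxy]) (hxx _ _)
        (by rw [hyx, if_neg hj.symm])
    · intro i
      obtain ⟨j, hj⟩ := hex i
      exact van t ht.rel 0 1 (x j) (y j) z _ (hx _) (hy _) (by simp [hxy])
        (by rw [hxy, if_neg hj]) (hyy _ _)

end SuperLie
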